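/- The map T : B_N → S* defined by (T f_μ)(g) := ∫_Θ g dμ for g ∈ S is well defined (independent of the measure μ representing f_μ), linear, bijective, and norm-preserving: ‖T f_μ‖_{S*} = ‖f_μ‖_{B_N} for all f_μ ∈ B_N. Hence B_N is isometrically isomorphic to the dual space of S; that is, S is a pre-dual space of B_N. -/

import Mathlib

open MeasureTheory Filter Topology
open scoped ZeroAtInfty BigOperators

noncomputable section

/-- The parameter space of a depth-`D` deep neural network with layer widths
`m 0, m 1, …, m D` (input dimension `m 0 = s`, output dimension `m D = t`). -/
abbrev Params (m : ℕ → ℕ) (D : ℕ) : Type :=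
  (j : Fin D) → ((Fin (m (j.1 + 1)) → Fin (m j.1) → ℝ) × (Fin (m (j.1 + 1)) → ℝ))

/-- The deep neural network `N(x, θ)` of depth `D`, defined recursively by
`N¹(x) = W₁ x + b₁` and `N^{j+1}(x) = W_{j+1} σ(N^j(x)) + b_{j+1}`. -/
def NNet (σ : ℝ → ℝ) (m : ℕ → ℕ) :
    (D : ℕ) → Params m D → (Fin (m 0) → ℝ) → Fin (m D) → ℝ
  | 0, _, x => x
  | 1, θ, x => fun i => (∑ k, (θ ⟨0, Nat.one_pos⟩).1 i k * x k) + (θ ⟨0, Nat.one_pos⟩).2 i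
  | (D + 2), θ, x => fun i =>
      (∑ k, (θ (Fin.last (D + 1))).1 i k *
          σ (NNet σ m (D + 1) (fun j => θ j.castSucc) x k))
        + (θ (Fin.last (D + 1))).2 i

/-- The integral of a function against a finite signed (Radon) measure,
via the Jordan decomposition. -/
def sInt {Θ : Type*} [MeasurableSpace Θ] (μ : SignedMeasure Θ) (f : Θ → ℝ) : ℝ :=
  (∫ θ, f θ ∂μ.toJordanDecomposition.posPart) - ∫ θ, f θ ∂μ.toJordanDecomposition.negPart

/-- The total variation norm of a signed measure. -/
def tvNorm {Θ : Type*} [MeasurableSpace Θ] (μ : SignedMeasure Θ) : ℝ :=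
  (μ.totalVariation Set.univ).toReal

/-- `f_μ^k(x) := ∫_Θ N_k(x,θ) ρ(θ) dμ(θ)`. -/
def fMu (σ : ℝ → ℝ) (m : ℕ → ℕ) (D : ℕ) (ρ : Params m D → ℝ)
    (μ : SignedMeasure (Params m D)) : (Fin (m 0) → ℝ) → Fin (m D) → ℝ :=
  fun x k => sInt μ fun θ => NNet σ m D θ x k * ρ θ

/-- The set `B_N = {f_μ : μ ∈ M(Θ)}`. -/
def BNset (σ : ℝ → ℝ) (m : ℕ → ℕ) (D : ℕ) (ρ : Params m D → ℝ) :
    Set ((Fin (m 0) → ℝ) → Fin (m D) → ℝ) :=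
  {f | ∃ μ : SignedMeasure (Params m D), fMu σ m D ρ μ = f}

/-- The norm `‖f‖_{B_N} = inf {‖ν‖_TV : f_ν = f}`. -/
def BNnorm (σ : ℝ → ℝ) (m : ℕ → ℕ) (D : ℕ) (ρ : Params m D → ℝ)
    (f : (Fin (m 0) → ℝ) → Fin (m D) → ℝ) : ℝ :=
  sInf (tvNorm '' {ν : SignedMeasure (Params m D) | fMu σ m D ρ ν = f})

/-- `S`: the closed linear span in `C₀(Θ)` of the functions `θ ↦ N_k(x,θ)ρ(θ)`
(given here as the bundled family `Kb`). -/
def Sspan (m : ℕ → ℕ) (D : ℕ)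
    (Kb : (Fin (m 0) → ℝ) → Fin (m D) → C₀(Params m D, ℝ)) :
    Submodule ℝ C₀(Params m D, ℝ) :=
  (Submodule.span ℝ
    (Set.range fun p : (Fin (m 0) → ℝ) × Fin (m D) => Kb p.1 p.2)).topologicalClosure

/-- `V_N := span {K_k(x_j, ·) : j, k}`. -/
def VN (m : ℕ → ℕ) (D : ℕ)
    (Kb : (Fin (m 0) → ℝ) → Fin (m D) → C₀(Params m D, ℝ))
    (M : ℕ) (x : Fin M → (Fin (m 0) → ℝ)) : Submodule ℝ C₀(Params m D, ℝ) :=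
  Submodule.span ℝ (Set.range fun p : Fin (m D) × Fin M => Kb (x p.2) p.1)

/-- The interpolation condition `f(x_j) = y_j`, i.e. `f_k(x_j) = y_j^k` for all `j, k`. -/
def interpolates (m : ℕ → ℕ) (D : ℕ) (M : ℕ) (x : Fin M → (Fin (m 0) → ℝ))
    (Y : Fin (m D) → Fin M → ℝ) (f : (Fin (m 0) → ℝ) → Fin (m D) → ℝ) : Prop :=
  ∀ (j : Fin M) (k : Fin (m D)), f (x j) k = Y k j

/-- The solution set `S_{X,Y}` of the MNI problem
`inf {‖f‖_{B_N} : f ∈ B_N, f(x_j) = y_j}`. -/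
def MNISolSet (σ : ℝ → ℝ) (m : ℕ → ℕ) (D : ℕ) (ρ : Params m D → ℝ)
    (M : ℕ) (x : Fin M → (Fin (m 0) → ℝ)) (Y : Fin (m D) → Fin M → ℝ) :
    Set ((Fin (m 0) → ℝ) → Fin (m D) → ℝ) :=
  {f | f ∈ BNset σ m D ρ ∧ interpolates m D M x Y f ∧
    ∀ μ : SignedMeasure (Params m D), interpolates m D M x Y (fMu σ m D ρ μ) →
      BNnorm σ m D ρ f ≤ BNnorm σ m D ρ (fMu σ m D ρ μ)}

/-- The solution set of the measure MNI problem
`inf {‖μ‖_TV : μ ∈ M(Θ), ∫ K_k(x_j,·) dμ = y_j^k}`. -/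
def MeasSolSet (σ : ℝ → ℝ) (m : ℕ → ℕ) (D : ℕ) (ρ : Params m D → ℝ)
    (M : ℕ) (x : Fin M → (Fin (m 0) → ℝ)) (Y : Fin (m D) → Fin M → ℝ) :
    Set (SignedMeasure (Params m D)) :=
  {μ | interpolates m D M x Y (fMu σ m D ρ μ) ∧
    ∀ ν : SignedMeasure (Params m D), interpolates m D M x Y (fMu σ m D ρ ν) →
      tvNorm μ ≤ tvNorm ν}

/-- The subdifferential `∂‖·‖_∞(g) ⊆ B_N` of the supremum norm at `g ∈ S`, viewing `B_N`
as the dual of `S` via the (representation independent) pairing `⟨f_μ, g⟩ = ∫ g dμ`: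
`∂‖·‖_∞(g) = {f_μ ∈ B_N : ‖f_μ‖_{B_N} = 1, ∫ g dμ = ‖g‖_∞}`. -/
def subdiffSup (σ : ℝ → ℝ) (m : ℕ → ℕ) (D : ℕ) (ρ : Params m D → ℝ)
    (g : C₀(Params m D, ℝ)) : Set ((Fin (m 0) → ℝ) → Fin (m D) → ℝ) :=
  {f | f ∈ BNset σ m D ρ ∧ BNnorm σ m D ρ f = 1 ∧
    ∀ μ : SignedMeasure (Params m D), fMu σ m D ρ μ = f → sInt μ (fun θ => g θ) = ‖g‖}

/-- Feasibility for the dual problem: `‖∑_{k,j} c_{kj} K_k(x_j,·)‖_∞ = 1`. -/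
def dualFeasible (m : ℕ → ℕ) (D : ℕ)
    (Kb : (Fin (m 0) → ℝ) → Fin (m D) → C₀(Params m D, ℝ))
    (M : ℕ) (x : Fin M → (Fin (m 0) → ℝ)) (c : Fin (m D) → Fin M → ℝ) : Prop :=
  ‖∑ k, ∑ j, c k j • Kb (x j) k‖ = 1

/-- The objective `∑_{k,j} c_{kj} y_j^k` of the dual problem. -/
def dualObjective (m : ℕ → ℕ) (D : ℕ) (M : ℕ) (Y : Fin (m D) → Fin M → ℝ)
    (c : Fin (m D) → Fin M → ℝ) : ℝ :=
  ∑ k, ∑ j, c k j * Y k j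

/-- `c` is a solution of the dual problem. -/
def dualSolves (m : ℕ → ℕ) (D : ℕ)
    (Kb : (Fin (m 0) → ℝ) → Fin (m D) → C₀(Params m D, ℝ))
    (M : ℕ) (x : Fin M → (Fin (m 0) → ℝ)) (Y : Fin (m D) → Fin M → ℝ)
    (c : Fin (m D) → Fin M → ℝ) : Prop :=
  dualFeasible m D Kb M x c ∧
    ∀ c' : Fin (m D) → Fin M → ℝ, dualFeasible m D Kb M x c' →
      dualObjective m D M Y c' ≤ dualObjective m D M Y c

/-- `ĝ := C* · ∑_{k,j} ĉ_{kj} K_k(x_j,·)`, where `C*` is the optimal dual value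
(the value of the dual objective at the dual solution `c`). -/
def ghat (m : ℕ → ℕ) (D : ℕ)
    (Kb : (Fin (m 0) → ℝ) → Fin (m D) → C₀(Params m D, ℝ))
    (M : ℕ) (x : Fin M → (Fin (m 0) → ℝ)) (Y : Fin (m D) → Fin M → ℝ)
    (c : Fin (m D) → Fin M → ℝ) : C₀(Params m D, ℝ) :=
  dualObjective m D M Y c • ∑ k, ∑ j, c k j • Kb (x j) k

/-- `Θ(g) := {θ ∈ Θ : |g(θ)| = ‖g‖_∞}`. -/
def ThetaSet (m : ℕ → ℕ) (D : ℕ) (g : C₀(Params m D, ℝ)) : Set (Params m D) :=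
  {θ | |g θ| = ‖g‖}

/-- The regularization objective `Q(I_X(f) − Y) + λ ‖f‖_{B_N}`. -/
def regObj (σ : ℝ → ℝ) (m : ℕ → ℕ) (D : ℕ) (ρ : Params m D → ℝ)
    (M : ℕ) (x : Fin M → (Fin (m 0) → ℝ)) (Y : Fin (m D) → Fin M → ℝ)
    (lam : ℝ) (Q : (Fin (m D) → Fin M → ℝ) → ℝ)
    (f : (Fin (m 0) → ℝ) → Fin (m D) → ℝ) : ℝ :=
  Q ((fun k j => f (x j) k) - Y) + lam * BNnorm σ m D ρ f

/-- The solution set `R_{X,Y}` of the regularization problem. -/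
def RegSolSet (σ : ℝ → ℝ) (m : ℕ → ℕ) (D : ℕ) (ρ : Params m D → ℝ)
    (M : ℕ) (x : Fin M → (Fin (m 0) → ℝ)) (Y : Fin (m D) → Fin M → ℝ)
    (lam : ℝ) (Q : (Fin (m D) → Fin M → ℝ) → ℝ) :
    Set ((Fin (m 0) → ℝ) → Fin (m D) → ℝ) :=
  {f | f ∈ BNset σ m D ρ ∧
    ∀ μ : SignedMeasure (Params m D),
      regObj σ m D ρ M x Y lam Q f ≤ regObj σ m D ρ M x Y lam Q (fMu σ m D ρ μ)}

/-- `D_{X,Y} := I_X(R_{X,Y})`. -/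
def DXY (σ : ℝ → ℝ) (m : ℕ → ℕ) (D : ℕ) (ρ : Params m D → ℝ)
    (M : ℕ) (x : Fin M → (Fin (m 0) → ℝ)) (Y : Fin (m D) → Fin M → ℝ)
    (lam : ℝ) (Q : (Fin (m D) → Fin M → ℝ) → ℝ) : Set (Fin (m D) → Fin M → ℝ) :=
  (fun f => fun k j => f (x j) k) '' RegSolSet σ m D ρ M x Y lam Q

section SignedMeasureIntegral

variable {X : Type*} [MeasurableSpace X]

lemma toSignedMeasure_jordan_sub (μ : SignedMeasure X) :
    μ.toJordanDecomposition.posPart.toSignedMeasure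
      - μ.toJordanDecomposition.negPart.toSignedMeasure = μ :=
  μ.toSignedMeasure_toJordanDecomposition

/-- A signed measure integral may be computed from any representation of the signed measure
as a difference of finite measures. -/
lemma sInt_toSignedMeasure_sub (a b : Measure X) [IsFiniteMeasure a] [IsFiniteMeasure b]
    {f : X → ℝ} (hf : ∀ ν : Measure X, IsFiniteMeasure ν → Integrable f ν) :
    sInt (a.toSignedMeasure - b.toSignedMeasure) f = ∫ x, f x ∂a - ∫ x, f x ∂b := by
  set μ := a.toSignedMeasure - b.toSignedMeasure with hμ
  set p := μ.toJordanDecomposition.posPart with hp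
  set n := μ.toJordanDecomposition.negPart with hn
  have key : p + b = a + n := by
    rw [← Measure.toSignedMeasure_eq_toSignedMeasure_iff, Measure.toSignedMeasure_add,
      Measure.toSignedMeasure_add, ← sub_eq_sub_iff_add_eq_add, ← hμ]
    exact toSignedMeasure_jordan_sub μ
  have h : ∫ x, f x ∂(p + b) = ∫ x, f x ∂(a + n) := by rw [key]
  rw [integral_add_measure (hf _ inferInstance) (hf _ inferInstance),
    integral_add_measure (hf _ inferInstance) (hf _ inferInstance)] at h
  unfold sInt
  linarith

lemma sInt_add (μ ν : SignedMeasure X) {f : X → ℝ}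
    (hf : ∀ ν : Measure X, IsFiniteMeasure ν → Integrable f ν) :
    sInt (μ + ν) f = sInt μ f + sInt ν f := by
  have h : μ + ν = (μ.toJordanDecomposition.posPart + ν.toJordanDecomposition.posPart).toSignedMeasure
      - (μ.toJordanDecomposition.negPart + ν.toJordanDecomposition.negPart).toSignedMeasure := by
    rw [Measure.toSignedMeasure_add, Measure.toSignedMeasure_add, add_sub_add_comm,
      toSignedMeasure_jordan_sub, toSignedMeasure_jordan_sub]
  rw [h, sInt_toSignedMeasure_sub _ _ hf,
    integral_add_measure (hf _ inferInstance) (hf _ inferInstance),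
    integral_add_measure (hf _ inferInstance) (hf _ inferInstance)]
  unfold sInt
  ring

lemma sInt_smul (c : ℝ) (μ : SignedMeasure X) (f : X → ℝ) :
    sInt (c • μ) f = c * sInt μ f := by
  unfold sInt
  rw [SignedMeasure.toJordanDecomposition_smul_real]
  rcases le_or_gt 0 c with hc | hc
  · rw [JordanDecomposition.real_smul_posPart_nonneg _ _ hc,
      JordanDecomposition.real_smul_negPart_nonneg _ _ hc,
      integral_smul_nnreal_measure, integral_smul_nnreal_measure]
    simp only [NNReal.smul_def, Real.coe_toNNReal _ hc, smul_eq_mul]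
    ring
  · rw [JordanDecomposition.real_smul_posPart_neg _ _ hc,
      JordanDecomposition.real_smul_negPart_neg _ _ hc,
      integral_smul_nnreal_measure, integral_smul_nnreal_measure]
    simp only [NNReal.smul_def, Real.coe_toNNReal _ (neg_nonneg.2 hc.le), smul_eq_mul]
    ring

lemma tvNorm_eq (μ : SignedMeasure X) :
    tvNorm μ = μ.toJordanDecomposition.posPart.real Set.univ
      + μ.toJordanDecomposition.negPart.real Set.univ := by
  unfold tvNorm SignedMeasure.totalVariation
  rw [Measure.add_apply, ENNReal.toReal_add (measure_ne_top _ _) (measure_ne_top _ _)]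
  rfl

lemma tvNorm_nonneg (μ : SignedMeasure X) : 0 ≤ tvNorm μ := ENNReal.toReal_nonneg

lemma tvNorm_toSignedMeasure_sub_le (a b : Measure X) [IsFiniteMeasure a] [IsFiniteMeasure b] :
    tvNorm (a.toSignedMeasure - b.toSignedMeasure) ≤ a.real Set.univ + b.real Set.univ := by
  set μ := a.toSignedMeasure - b.toSignedMeasure with hμ
  have hval : ∀ t, MeasurableSet t → μ t = a.real t - b.real t := fun t ht => by
    rw [hμ, Measure.toSignedMeasure_sub_apply ht]
  have hj : ∀ t, MeasurableSet t → μ t = μ.toJordanDecomposition.posPart.real t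
      - μ.toJordanDecomposition.negPart.real t := fun t ht =>
    μ.apply_eq_posPart_real_sub_negPart_real ht
  obtain ⟨t, ht, hpt, hnt⟩ := μ.toJordanDecomposition.mutuallySingular
  have h1 := measureReal_add_measureReal_compl (μ := μ.toJordanDecomposition.posPart) ht
  have h2 := measureReal_add_measureReal_compl (μ := μ.toJordanDecomposition.negPart) ht
  have h3 := measureReal_add_measureReal_compl (μ := a) ht
  have h4 := measureReal_add_measureReal_compl (μ := b) ht
  have h5 : μ.toJordanDecomposition.posPart.real t = 0 := by simp [measureReal_def, hpt]
  have h6 : μ.toJordanDecomposition.negPart.real tᶜ = 0 := by simp [measureReal_def, hnt]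
  have h7 := (hval t ht).symm.trans (hj t ht)
  have h8 := (hval _ ht.compl).symm.trans (hj _ ht.compl)
  have h9 : 0 ≤ a.real t := measureReal_nonneg
  have h10 : 0 ≤ b.real tᶜ := measureReal_nonneg
  rw [tvNorm_eq]
  linarith

end SignedMeasureIntegral

/-- **Hahn-Banach**, with the norm of the functional written as a supremum over the unit ball. -/
lemma exists_extension_opNorm_eq_sSup {E : Type*} [NormedAddCommGroup E] [NormedSpace ℝ E]
    (S : Submodule ℝ E) (φ : S →L[ℝ] ℝ) :
    ∃ ψ : E →L[ℝ] ℝ, ψ.comp S.subtypeL = φ ∧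
      ‖ψ‖ = sSup {r : ℝ | ∃ g : S, ‖g‖ ≤ 1 ∧ r = |φ g|} := by
  obtain ⟨ψ, hψ, hnorm⟩ := exists_extension_norm_eq S φ
  refine ⟨ψ, ContinuousLinearMap.ext hψ, ?_⟩
  rw [hnorm, ← φ.sSup_unitClosedBall_eq_norm]
  congr 1
  ext r
  simp [eq_comm]

section Riesz

open scoped CompactlySupported Pointwise

variable {X : Type*} [TopologicalSpace X]

lemma C0_abs_le_norm (g : C₀(X, ℝ)) (x : X) : |g x| ≤ ‖g‖ :=
  g.toBCF.norm_coe_le_norm x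

lemma C0_norm_le {g : C₀(X, ℝ)} {C : ℝ} (hC : 0 ≤ C) (h : ∀ x, |g x| ≤ C) : ‖g‖ ≤ C :=
  (BoundedContinuousFunction.norm_le (f := g.toBCF) hC).2 h

/-- A nonnegative compactly supported function, viewed as an element of `C₀(X, ℝ)`. -/
def toC0 (f : C_c(X, NNReal)) : C₀(X, ℝ) :=
  ⟨f.toReal.toContinuousMap, zero_at_infty f.toReal⟩

@[simp] lemma toC0_apply (f : C_c(X, NNReal)) (x : X) : toC0 f x = f x := f.toReal_apply x

lemma toC0_add (f g : C_c(X, NNReal)) : toC0 (f + g) = toC0 f + toC0 g := by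
  ext x; simp

lemma toC0_smul (c : NNReal) (f : C_c(X, NNReal)) : toC0 (c • f) = (c : ℝ) • toC0 f := by
  ext x; simp

lemma toC0_norm_mono {f g : C_c(X, NNReal)} (h : f ≤ g) : ‖toC0 f‖ ≤ ‖toC0 g‖ := by
  refine C0_norm_le (norm_nonneg _) fun x => le_trans ?_ (C0_abs_le_norm _ x)
  simpa using h x

/-- The values of `ψ` on `[0, f]`; their supremum is the positive part of `ψ` at `f`. -/
def intervalValues (ψ : C₀(X, ℝ) →L[ℝ] ℝ) (f : C_c(X, NNReal)) : Set ℝ :=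
  (fun h => ψ (toC0 h)) '' Set.Iic f

variable (ψ : C₀(X, ℝ) →L[ℝ] ℝ)

lemma intervalValues_bddAbove (f : C_c(X, NNReal)) : BddAbove (intervalValues ψ f) := by
  refine ⟨‖ψ‖ * ‖toC0 f‖, ?_⟩
  rintro _ ⟨h, hh, rfl⟩
  exact (le_abs_self _).trans ((ψ.le_opNorm _).trans
    (mul_le_mul_of_nonneg_left (toC0_norm_mono hh) (norm_nonneg _)))

lemma zero_mem_intervalValues (f : C_c(X, NNReal)) : 0 ∈ intervalValues ψ f := by
  refine ⟨0, fun x => by simp, ?_⟩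
  have : toC0 (0 : C_c(X, NNReal)) = 0 := by ext x; simp
  simp [this]

lemma intervalValues_add (f g : C_c(X, NNReal)) :
    intervalValues ψ (f + g) = intervalValues ψ f + intervalValues ψ g := by
  ext r
  rw [Set.mem_add]
  constructor
  · rintro ⟨h, hh, rfl⟩
    obtain ⟨k, hk⟩ := CompactlySupportedContinuousMap.exists_add_of_le (inf_le_left : h ⊓ f ≤ h)
    refine ⟨_, ⟨h ⊓ f, Set.mem_Iic.2 inf_le_right, rfl⟩, _, ⟨k, fun x => ?_, rfl⟩, ?_⟩
    · have h1 := DFunLike.congr_fun hk x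
      have h2 : h x ≤ f x + g x := hh x
      simp only [CompactlySupportedContinuousMap.add_apply,
        CompactlySupportedContinuousMap.inf_apply] at h1
      change k x ≤ g x
      rcases le_total (h x) (f x) with h3 | h3
      · rw [inf_eq_left.2 h3] at h1
        have : k x = 0 := by simpa using h1
        simp [this]
      · rw [inf_eq_right.2 h3, ← h1] at *
        rw [← h1] at h2
        exact le_of_add_le_add_left h2
    · simp only
      rw [← map_add, ← toC0_add, hk]
  · rintro ⟨_, ⟨h, hh, rfl⟩, _, ⟨k, hk, rfl⟩, rfl⟩
    refine ⟨h + k, fun x => add_le_add (hh x) (hk x), ?_⟩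
    simp only [toC0_add, map_add]

lemma intervalValues_smul (c : NNReal) (f : C_c(X, NNReal)) :
    intervalValues ψ (c • f) = (c : ℝ) • intervalValues ψ f := by
  ext r
  rw [Set.mem_smul_set]
  constructor
  · rintro ⟨h, hh, rfl⟩
    rcases eq_or_ne c 0 with rfl | hc
    · refine ⟨0, zero_mem_intervalValues ψ f, ?_⟩
      have : toC0 h = 0 := by
        ext x
        have : h x ≤ 0 := by simpa using hh x
        simp [nonpos_iff_eq_zero.1 this]
      simp [this]
    · refine ⟨_, ⟨c⁻¹ • h, fun x => ?_, rfl⟩, ?_⟩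
      · have h1 : h x ≤ c * f x := by simpa using hh x
        change c⁻¹ * h x ≤ f x
        rwa [inv_mul_le_iff₀ (pos_iff_ne_zero.2 hc)]
      · simp only
        rw [← map_smul, ← toC0_smul, smul_inv_smul₀ hc]
  · rintro ⟨_, ⟨h, hh, rfl⟩, rfl⟩
    refine ⟨c • h, fun x => ?_, ?_⟩
    · change c * h x ≤ c * f x
      exact mul_le_mul_right (hh x) c
    · simp only [toC0_smul, map_smul]

/-- The positive part of a continuous linear functional on `C₀(X, ℝ)`. -/
def posPartFunctional : C_c(X, NNReal) →ₗ[NNReal] NNReal where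
  toFun f := ⟨sSup (intervalValues ψ f),
    le_csSup (intervalValues_bddAbove ψ f) (zero_mem_intervalValues ψ f)⟩
  map_add' f g := by
    ext
    change sSup _ = sSup _ + sSup _
    rw [intervalValues_add, csSup_add ⟨0, zero_mem_intervalValues ψ f⟩
      (intervalValues_bddAbove ψ f) ⟨0, zero_mem_intervalValues ψ g⟩
      (intervalValues_bddAbove ψ g)]
  map_smul' c f := by
    ext
    change sSup (intervalValues ψ (c • f)) = c * sSup (intervalValues ψ f)
    rw [intervalValues_smul]
    exact Real.sSup_smul_of_nonneg c.coe_nonneg (intervalValues ψ f)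

lemma coe_posPartFunctional (f : C_c(X, NNReal)) :
    (posPartFunctional ψ f : ℝ) = sSup (intervalValues ψ f) := rfl

lemma le_posPartFunctional (f : C_c(X, NNReal)) : ψ (toC0 f) ≤ posPartFunctional ψ f :=
  le_csSup (intervalValues_bddAbove ψ f) ⟨f, Set.mem_Iic.2 le_rfl, rfl⟩

/-- The negative part of a continuous linear functional on `C₀(X, ℝ)`. -/
def negPartFunctional : C_c(X, NNReal) →ₗ[NNReal] NNReal where
  toFun f := ⟨posPartFunctional ψ f - ψ (toC0 f), sub_nonneg.2 (le_posPartFunctional ψ f)⟩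
  map_add' f g := by
    ext
    change (posPartFunctional ψ (f + g) : ℝ) - ψ (toC0 (f + g))
      = (posPartFunctional ψ f - ψ (toC0 f)) + (posPartFunctional ψ g - ψ (toC0 g))
    rw [map_add, toC0_add, map_add, NNReal.coe_add]
    ring
  map_smul' c f := by
    ext
    change (posPartFunctional ψ (c • f) : ℝ) - ψ (toC0 (c • f))
      = c * (posPartFunctional ψ f - ψ (toC0 f))
    rw [map_smul, toC0_smul, map_smul, smul_eq_mul, smul_eq_mul, NNReal.coe_mul]
    ring

lemma coe_negPartFunctional (f : C_c(X, NNReal)) :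
    (negPartFunctional ψ f : ℝ) = posPartFunctional ψ f - ψ (toC0 f) := rfl

lemma posPart_add_negPart_le {f : C_c(X, NNReal)} (hf : ∀ x, f x ≤ 1) :
    (posPartFunctional ψ f : ℝ) + negPartFunctional ψ f ≤ ‖ψ‖ := by
  have h : sSup (intervalValues ψ f) ≤ (‖ψ‖ + ψ (toC0 f)) / 2 := by
    refine csSup_le ⟨0, zero_mem_intervalValues ψ f⟩ ?_
    rintro _ ⟨h, hh, rfl⟩
    have h1 : ‖(2 : ℝ) • toC0 h - toC0 f‖ ≤ 1 := by
      refine C0_norm_le zero_le_one fun x => ?_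
      have h2 : (h x : ℝ) ≤ f x := hh x
      have h3 : (f x : ℝ) ≤ 1 := hf x
      have h4 : (0 : ℝ) ≤ h x := (h x).2
      rw [ZeroAtInftyContinuousMap.sub_apply, ZeroAtInftyContinuousMap.smul_apply, toC0_apply,
        toC0_apply, smul_eq_mul, abs_le]
      constructor <;> linarith
    have h2 := (le_abs_self _).trans ((ψ.le_opNorm ((2 : ℝ) • toC0 h - toC0 f)).trans
      (mul_le_of_le_one_right (norm_nonneg _) h1))
    rw [map_sub, map_smul, smul_eq_mul] at h2
    change ψ (toC0 h) ≤ _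
    linarith
  rw [coe_negPartFunctional, coe_posPartFunctional]
  linarith

lemma exists_compactlySupported_approx [T2Space X] (g : C₀(X, ℝ)) {ε : ℝ} (hε : 0 < ε) :
    ∃ f : C_c(X, ℝ), ∀ x, |g x - f x| ≤ ε := by
  have hcont : Continuous fun x => g x - max (-ε) (min (g x) ε) := by fun_prop
  have hev : ∀ᶠ x in cocompact X, |g x| < ε := by
    have := (zero_at_infty g).abs
    rw [abs_zero] at this
    exact this.eventually_lt_const hε
  obtain ⟨K, hK, hKs⟩ := mem_cocompact.1 hev
  refine ⟨⟨⟨_, hcont⟩, HasCompactSupport.intro hK fun x hx => ?_⟩, fun x => ?_⟩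
  · have hx' : |g x| < ε := hKs hx
    have h := abs_lt.1 hx'
    change g x - max (-ε) (min (g x) ε) = 0
    rw [min_eq_left h.2.le, max_eq_right h.1.le, sub_self]
  · change |g x - (g x - max (-ε) (min (g x) ε))| ≤ ε
    rw [sub_sub_cancel, abs_le]
    exact ⟨le_max_left _ _, max_le (by linarith) (min_le_right _ _)⟩

lemma dense_range_toC0_sub [T2Space X] :
    DenseRange fun p : C_c(X, NNReal) × C_c(X, NNReal) => toC0 p.1 - toC0 p.2 := by
  refine Metric.denseRange_iff.2 fun g ε hε => ?_
  obtain ⟨f, hf⟩ := exists_compactlySupported_approx g (half_pos hε)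
  refine ⟨(f.nnrealPart, (-f).nnrealPart), lt_of_le_of_lt ?_ (half_lt_self hε)⟩
  rw [dist_eq_norm]
  refine C0_norm_le (half_pos hε).le fun x => ?_
  have h := DFunLike.congr_fun f.nnrealPart_sub_nnrealPart_neg x
  rw [CompactlySupportedContinuousMap.sub_apply, CompactlySupportedContinuousMap.toReal_apply,
    CompactlySupportedContinuousMap.toReal_apply] at h
  rw [ZeroAtInftyContinuousMap.sub_apply, ZeroAtInftyContinuousMap.sub_apply, toC0_apply,
    toC0_apply, h]
  exact hf x

variable [MeasurableSpace X] [BorelSpace X]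

lemma C0_integrable (g : C₀(X, ℝ)) (ν : Measure X) (hν : IsFiniteMeasure ν) :
    Integrable (fun x => g x) ν :=
  g.toBCF.integrable ν

/-- Integration of `C₀` functions against a finite measure. -/
def integralC0 (ν : Measure X) [IsFiniteMeasure ν] : C₀(X, ℝ) →L[ℝ] ℝ :=
  LinearMap.mkContinuous
    { toFun := fun g => ∫ x, g x ∂ν
      map_add' := fun f g => integral_add (C0_integrable f ν inferInstance)
        (C0_integrable g ν inferInstance)
      map_smul' := fun c g => integral_const_mul c _ }
    (ν.real Set.univ) fun g => by
      refine (norm_integral_le_of_norm_le_const (C := ‖g‖)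
        (ae_of_all _ (C0_abs_le_norm g))).trans_eq (mul_comm _ _)

lemma integralC0_apply (ν : Measure X) [IsFiniteMeasure ν] (g : C₀(X, ℝ)) :
    integralC0 ν g = ∫ x, g x ∂ν := rfl

lemma abs_integralC0_le (ν : Measure X) [IsFiniteMeasure ν] (g : C₀(X, ℝ)) :
    |integralC0 ν g| ≤ ν.real Set.univ * ‖g‖ := by
  rw [mul_comm, integralC0_apply, ← Real.norm_eq_abs]
  exact norm_integral_le_of_norm_le_const (ae_of_all ν (C0_abs_le_norm g))

/-- Integration of `C₀` functions against a signed measure. -/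
def sIntC0 (μ : SignedMeasure X) : C₀(X, ℝ) →L[ℝ] ℝ :=
  integralC0 μ.toJordanDecomposition.posPart - integralC0 μ.toJordanDecomposition.negPart

lemma sIntC0_apply (μ : SignedMeasure X) (g : C₀(X, ℝ)) :
    sIntC0 μ g = sInt μ (fun x => g x) := rfl

lemma abs_sIntC0_le (μ : SignedMeasure X) (g : C₀(X, ℝ)) :
    |sIntC0 μ g| ≤ tvNorm μ * ‖g‖ := by
  rw [tvNorm_eq, add_mul]
  exact (abs_sub _ _).trans (add_le_add (abs_integralC0_le _ _) (abs_integralC0_le _ _))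

/-- The **Riesz representation theorem** for the dual of `C₀(X, ℝ)`. -/
theorem exists_signedMeasure_eq_sIntC0 [T2Space X] [LocallyCompactSpace X] :
    ∃ μ : SignedMeasure X, sIntC0 μ = ψ ∧ tvNorm μ ≤ ‖ψ‖ := by
  set a := NNRealRMK.rieszMeasure (posPartFunctional ψ) with ha
  set b := NNRealRMK.rieszMeasure (negPartFunctional ψ) with hb
  have hcpt : ∀ K L : Set X, IsCompact K → IsCompact L → a K + b L ≤ ENNReal.ofReal ‖ψ‖ := by
    intro K L hK hL
    obtain ⟨f, hf1, -, hfc, hf01⟩ :=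
      exists_continuous_one_zero_of_isCompact (hK.union hL) isClosed_empty (Set.disjoint_empty _)
    set g : C_c(X, NNReal) := (⟨f, hfc⟩ : C_c(X, ℝ)).nnrealPart with hg
    have hgv : ∀ x, g x = (f x).toNNReal := fun x => rfl
    have hg1 : ∀ x, g x ≤ 1 := fun x => by
      rw [hgv, Real.toNNReal_le_one]; exact (hf01 x).2
    have hbound : ∀ (Λ : C_c(X, NNReal) →ₗ[NNReal] NNReal) (M : Set X), IsCompact M →
        M ⊆ K ∪ L → NNRealRMK.rieszMeasure Λ M ≤ Λ g := by
      intro Λ M hM hMs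
      rw [← NNRealRMK.lintegral_rieszMeasure Λ g]
      calc NNRealRMK.rieszMeasure Λ M
          = ∫⁻ x in M, 1 ∂(NNRealRMK.rieszMeasure Λ) := by simp
        _ ≤ ∫⁻ x in M, g x ∂(NNRealRMK.rieszMeasure Λ) := by
            refine setLIntegral_mono' hM.measurableSet fun x hx => ?_
            rw [hgv, hf1 (hMs hx)]
            simp
        _ ≤ _ := setLIntegral_le_lintegral _ _
    refine (add_le_add (hbound _ K hK Set.subset_union_left)
      (hbound _ L hL Set.subset_union_right)).trans ?_
    rw [← ENNReal.coe_add, ← ENNReal.ofReal_coe_nnreal]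
    exact ENNReal.ofReal_le_ofReal (by simpa using posPart_add_negPart_le ψ hg1)
  have huniv : a Set.univ + b Set.univ ≤ ENNReal.ofReal ‖ψ‖ := by
    rw [isOpen_univ.measure_eq_iSup_isCompact, isOpen_univ.measure_eq_iSup_isCompact]
    simp only [Set.subset_univ, iSup_pos]
    simp only [iSup_subtype']
    have : Nonempty {K : Set X // IsCompact K} := ⟨⟨∅, isCompact_empty⟩⟩
    rw [ENNReal.iSup_add]
    refine iSup_le fun K => ?_
    rw [ENNReal.add_iSup]
    exact iSup_le fun L => hcpt K L K.2 L.2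
  have hfa : IsFiniteMeasure a :=
    ⟨(le_self_add.trans huniv).trans_lt ENNReal.ofReal_lt_top⟩
  have hfb : IsFiniteMeasure b :=
    ⟨(le_add_self.trans huniv).trans_lt ENNReal.ofReal_lt_top⟩
  refine ⟨a.toSignedMeasure - b.toSignedMeasure, ?_, ?_⟩
  · have hnn : ∀ f : C_c(X, NNReal),
        sIntC0 (a.toSignedMeasure - b.toSignedMeasure) (toC0 f) = ψ (toC0 f) := fun f => by
      rw [sIntC0_apply, sInt_toSignedMeasure_sub _ _ (C0_integrable _)]
      simp only [toC0_apply]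
      rw [ha, hb, NNRealRMK.integral_rieszMeasure, NNRealRMK.integral_rieszMeasure,
        coe_negPartFunctional, sub_sub_cancel]
    refine DFunLike.coe_injective (dense_range_toC0_sub.equalizer
      (ContinuousLinearMap.continuous _) ψ.continuous (funext fun p => ?_))
    simp only [Function.comp_apply, map_sub, hnn]
  · refine (tvNorm_toSignedMeasure_sub_le a b).trans ?_
    rw [measureReal_def, measureReal_def,
      ← ENNReal.toReal_add (measure_ne_top _ _) (measure_ne_top _ _)]
    exact ENNReal.toReal_le_of_le_ofReal ψ.opNorm_nonneg huniv

/-- Every continuous functional on a subspace of `C₀(X, ℝ)` is represented by a signed measure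
whose total variation does not exceed the norm of the functional. -/
theorem exists_signedMeasure_of_subspace [T2Space X] [LocallyCompactSpace X]
    (S : Submodule ℝ C₀(X, ℝ)) (φ : S →L[ℝ] ℝ) :
    ∃ μ : SignedMeasure X, (sIntC0 μ).comp S.subtypeL = φ ∧
      tvNorm μ ≤ sSup {r : ℝ | ∃ g : S, ‖g‖ ≤ 1 ∧ r = |φ g|} := by
  obtain ⟨ψ, hψ, hnorm⟩ := exists_extension_opNorm_eq_sSup S φ
  obtain ⟨μ, hμ, htv⟩ := exists_signedMeasure_eq_sIntC0 ψ
  exact ⟨μ, hμ ▸ hψ, htv.trans_eq hnorm⟩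

end Riesz

/-- The map `T : B_N → S*`, `(T f_μ)(g) := ∫_Θ g dμ`, is well defined
(independent of the representing measure), linear, bijective, and norm-preserving, where
`‖φ‖_{S*} = sup {|φ(g)| : ‖g‖ ≤ 1}` is the dual norm.  Hence `B_N` is isometrically
isomorphic to the dual of `S`; i.e. `S` is a pre-dual of `B_N`.  (`T` is given on
representing measures; the second conjunct states simultaneously that it is independent
of the representative and injective on `B_N`.) -/
theorem statement_5
    (σ : ℝ → ℝ) (hσ : Continuous σ) (m : ℕ → ℕ) (D : ℕ) (hD : 0 < D)
    (ρ : Params m D → ℝ) (hρc : Continuous ρ) (hρpos : ∀ θ, 0 < ρ θ)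
    (Kb : (Fin (m 0) → ℝ) → Fin (m D) → C₀(Params m D, ℝ))
    (hKb : ∀ x k θ, Kb x k θ = NNet σ m D θ x k * ρ θ) :
    ∃ T : SignedMeasure (Params m D) → (↥(Sspan m D Kb) →L[ℝ] ℝ),
      (∀ (μ : SignedMeasure (Params m D)) (g : ↥(Sspan m D Kb)),
          T μ g = sInt μ (fun θ => (g : C₀(Params m D, ℝ)) θ))
      ∧ (∀ μ ν : SignedMeasure (Params m D), fMu σ m D ρ μ = fMu σ m D ρ ν ↔ T μ = T ν)
      ∧ (∀ μ ν : SignedMeasure (Params m D), T (μ + ν) = T μ + T ν)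
      ∧ (∀ (c : ℝ) (μ : SignedMeasure (Params m D)), T (c • μ) = c • T μ)
      ∧ (∀ φ : ↥(Sspan m D Kb) →L[ℝ] ℝ, ∃ μ, T μ = φ)
      ∧ ∀ μ : SignedMeasure (Params m D),
          sSup {r : ℝ | ∃ g : ↥(Sspan m D Kb), ‖g‖ ≤ 1 ∧ r = |T μ g|}
            = BNnorm σ m D ρ (fMu σ m D ρ μ) := by
  have hfMu : ∀ μ x k, fMu σ m D ρ μ x k = sIntC0 μ (Kb x k) := fun μ x k => by
    simp only [fMu, sIntC0_apply, hKb]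
  have hiff : ∀ μ ν : SignedMeasure (Params m D), fMu σ m D ρ μ = fMu σ m D ρ ν ↔
      (sIntC0 μ).comp (Sspan m D Kb).subtypeL = (sIntC0 ν).comp (Sspan m D Kb).subtypeL := by
    intro μ ν
    constructor
    · intro h
      have hle : Sspan m D Kb ≤ (sIntC0 μ - sIntC0 ν).ker := by
        refine Submodule.topologicalClosure_minimal _ (Submodule.span_le.2 ?_)
          (sIntC0 μ - sIntC0 ν).isClosed_ker
        rintro _ ⟨⟨x, k⟩, rfl⟩
        have h' : sIntC0 μ (Kb x k) = sIntC0 ν (Kb x k) := by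
          rw [← hfMu, ← hfMu, h]
        simpa [sub_eq_zero] using h'
      refine ContinuousLinearMap.ext fun g => ?_
      simpa [sub_eq_zero] using hle g.2
    · intro h
      funext x k
      have hmem : Kb x k ∈ Sspan m D Kb :=
        Submodule.le_topologicalClosure _ (Submodule.subset_span ⟨(x, k), rfl⟩)
      rw [hfMu, hfMu]
      exact DFunLike.congr_fun h ⟨Kb x k, hmem⟩
  refine ⟨fun μ => (sIntC0 μ).comp (Sspan m D Kb).subtypeL, fun μ g => rfl, hiff,
    fun μ ν => ContinuousLinearMap.ext fun g => sInt_add μ ν (C0_integrable _),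
    fun c μ => ContinuousLinearMap.ext fun g => sInt_smul c μ _, fun φ => ?_, fun μ => ?_⟩
  · obtain ⟨μ, hμ, -⟩ := exists_signedMeasure_of_subspace (Sspan m D Kb) φ
    exact ⟨μ, hμ⟩
  · apply le_antisymm
    · refine le_csInf ⟨_, μ, rfl, rfl⟩ ?_
      rintro _ ⟨ν, hν, rfl⟩
      simp only [(hiff μ ν).1 hν.symm]
      refine Real.sSup_le ?_ (tvNorm_nonneg ν)
      rintro _ ⟨g, hg, rfl⟩
      exact (abs_sIntC0_le ν g).trans (mul_le_of_le_one_right (tvNorm_nonneg ν) hg)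
    · obtain ⟨ν, hν, htv⟩ := exists_signedMeasure_of_subspace (Sspan m D Kb)
        ((sIntC0 μ).comp (Sspan m D Kb).subtypeL)
      have hbdd : BddBelow (tvNorm '' {ξ | fMu σ m D ρ ξ = fMu σ m D ρ μ}) :=
        ⟨0, by rintro _ ⟨ξ, -, rfl⟩; exact tvNorm_nonneg ξ⟩
      exact (csInf_le hbdd ⟨ν, (hiff ν μ).2 hν, rfl⟩).trans htv

end
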